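/- Let R₁ and R₂ be two reward functions on the same environment that agree on non-terminal transitions, each satisfying the mastery hypotheses with the same rMIN, rMAX, D and r̄MIN, and additionally suppose all non-terminal rewards are non-positive: R₁(s, a, T(s, a)) ≤ 0 whenever s ∉ Abs and T(s, a) ∉ Abs. Then for every s ∉ Abs and every g ∈ G reachable from s, V̄*₂(s, g) = V̄*₁(s, g) + (Rterm₂(g) − V̄*₁(g, g)), where Rterm₂(g) is the supremum over {a ∈ A : T(g, a) ∈ Abs} of R₂(g, a, T(g, a)). -/

import Mathlib

open Classical

/-- The state reached after `i` steps when starting in `s` and executing the actions in `as`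
(deterministic transition function `T`). `stateAt T s as 0 = s` and
`stateAt T s as (i+1) = T (stateAt T s as i) (as[i])`. -/
def stateAt {S A : Type*} (T : S → A → S) (s : S) (as : List A) (i : ℕ) : S :=
  (as.take i).foldl T s

/-- `as` is a terminating trajectory from `s`: it is nonempty, the final induced state is
absorbing, and no earlier induced state is absorbing. -/
def Terminating {S A : Type*} (T : S → A → S) (Abs : Set S) (s : S) (as : List A) : Prop :=
  as ≠ [] ∧ stateAt T s as as.length ∈ Abs ∧ ∀ i < as.length, stateAt T s as i ∉ Abs

/-- The achieved goal of a trajectory: the state from which the terminal transition is taken. -/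
def achievedGoal {S A : Type*} (T : S → A → S) (s : S) (as : List A) : S :=
  stateAt T s as (as.length - 1)

/-- The return of a trajectory under reward function `R`: the sum of the one-step rewards. -/
def ret {S A : Type*} (T : S → A → S) (R : S → A → S → ℝ) : S → List A → ℝ
  | _, [] => 0
  | s, a :: as => R s a (T s a) + ret T R (T s a) as

/-- The internal goal set: all states from which some action leads to an absorbing state. -/
def goalSet {S A : Type*} (T : S → A → S) (Abs : Set S) : Set S :=
  {s | ∃ a : A, T s a ∈ Abs}

/-- The goal-oriented reward: a penalty `rbMIN` for terminal transitions taken from a state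
other than the goal `g`, and the task reward `R` otherwise. -/
noncomputable def Rbar {S A : Type*} (Abs : Set S) (rbMIN : ℝ) (R : S → A → S → ℝ) (g : S) :
    S → A → S → ℝ :=
  fun s a s' => if s ≠ g ∧ s' ∈ Abs then rbMIN else R s a s'

/-- The optimal value `Q*(s, a)`: the supremum of returns under `R` over terminating
trajectories from `s` whose first action is `a`. -/
noncomputable def Qstar {S A : Type*} (T : S → A → S) (Abs : Set S) (R : S → A → S → ℝ)
    (s : S) (a : A) : ℝ :=
  sSup {x | ∃ as : List A, Terminating T Abs s as ∧ as.head? = some a ∧ ret T R s as = x}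

/-- The optimal state value `V*(s) = sup_a Q*(s, a)`. -/
noncomputable def Vstar {S A : Type*} (T : S → A → S) (Abs : Set S) (R : S → A → S → ℝ)
    (s : S) : ℝ :=
  sSup (Set.range (Qstar T Abs R s))

/-- The optimal world value `Q̄*(s, g, a)`: the optimal value for the goal-oriented reward. -/
noncomputable def Qbar {S A : Type*} (T : S → A → S) (Abs : Set S) (rbMIN : ℝ)
    (R : S → A → S → ℝ) (s g : S) (a : A) : ℝ :=
  Qstar T Abs (Rbar Abs rbMIN R g) s a

/-- The optimal world state value `V̄*(s, g) = sup_a Q̄*(s, g, a)`. -/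
noncomputable def Vbar {S A : Type*} (T : S → A → S) (Abs : Set S) (rbMIN : ℝ)
    (R : S → A → S → ℝ) (s g : S) : ℝ :=
  sSup (Set.range (Qbar T Abs rbMIN R s g))

/-- The environment is proper with horizon `D`: from every non-absorbing state some
terminating trajectory exists, and every terminating trajectory has length at most `D`. -/
def Proper {S A : Type*} (T : S → A → S) (Abs : Set S) (D : ℕ) : Prop :=
  1 ≤ D ∧ (∀ s ∉ Abs, ∃ as : List A, Terminating T Abs s as) ∧
    ∀ (s : S) (as : List A), Terminating T Abs s as → as.length ≤ D

/-- `g` is reachable from `s`: some terminating trajectory from `s` has achieved goal `g`. -/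
def Reachable {S A : Type*} (T : S → A → S) (Abs : Set S) (s g : S) : Prop :=
  ∃ as : List A, Terminating T Abs s as ∧ achievedGoal T s as = g

/-- The optimal terminal reward at a goal state `g`: the supremum of `R(g, a, T(g, a))`
over actions `a` whose transition from `g` is terminal. -/
noncomputable def Rterm {S A : Type*} (T : S → A → S) (Abs : Set S) (R : S → A → S → ℝ)
    (g : S) : ℝ :=
  sSup {x | ∃ a : A, T g a ∈ Abs ∧ R g a (T g a) = x}

/-- `p` is a path from `s` to `g` through non-absorbing states only. -/
def NPath {S A : Type*} (T : S → A → S) (Abs : Set S) (g : S) : S → List A → Prop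
  | s, [] => s = g ∧ s ∉ Abs
  | s, a :: as => s ∉ Abs ∧ NPath T Abs g (T s a) as

theorem NPath.start {S A : Type*} {T : S → A → S} {Abs : Set S} {g s : S} {p : List A}
    (h : NPath T Abs g s p) : s ∉ Abs := by
  cases p with
  | nil => exact h.2
  | cons a as => exact h.1

theorem NPath.goal {S A : Type*} {T : S → A → S} {Abs : Set S} {g : S} {p : List A} :
    ∀ {s : S}, NPath T Abs g s p → g ∉ Abs := by
  induction p with
  | nil => intro s h; exact h.1 ▸ h.2
  | cons a as ih => intro s h; exact ih h.2

theorem terminating_cons {S A : Type*} (T : S → A → S) (Abs : Set S) (s : S) (a : A)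
    (as : List A) : Terminating T Abs s (a :: as) ↔
      s ∉ Abs ∧ ((as = [] ∧ T s a ∈ Abs) ∨ Terminating T Abs (T s a) as) := by
  have hs : ∀ i, stateAt T s (a :: as) (i + 1) = stateAt T (T s a) as i := by
    intro i; simp [stateAt]
  have h0 : stateAt T s (a :: as) 0 = s := by simp [stateAt]
  constructor
  · rintro ⟨-, h2, h3⟩
    refine ⟨by simpa [h0] using h3 0 (by simp), ?_⟩
    rw [List.length_cons, hs] at h2
    by_cases he : as = []
    · left; subst he; exact ⟨rfl, by simpa [stateAt] using h2⟩
    · right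
      refine ⟨he, h2, fun i hi => ?_⟩
      rw [← hs]; exact h3 (i + 1) (by simpa using hi)
  · rintro ⟨h1, h2⟩
    rcases h2 with ⟨rfl, h2⟩ | ⟨-, h2, h3⟩
    · refine ⟨by simp, by simpa [stateAt] using h2, fun i hi => ?_⟩
      have : i = 0 := by simpa using hi
      subst this; rwa [h0]
    · refine ⟨by simp, by rw [List.length_cons, hs]; exact h2, fun i hi => ?_⟩
      cases i with
      | zero => rwa [h0]
      | succ i => rw [hs]; exact h3 i (by simpa using hi)

theorem terminating_decomp {S A : Type*} (T : S → A → S) (Abs : Set S) (as : List A) :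
    ∀ s, Terminating T Abs s as → ∃ p a, as = p ++ [a] ∧
      NPath T Abs (achievedGoal T s as) s p ∧ T (achievedGoal T s as) a ∈ Abs := by
  induction as with
  | nil => intro s h; exact absurd rfl h.1
  | cons a as ih =>
    intro s h
    obtain ⟨h1, ⟨rfl, h2⟩ | h2⟩ := (terminating_cons T Abs s a as).1 h
    · refine ⟨[], a, rfl, ?_, ?_⟩
      · simpa [NPath, achievedGoal, stateAt] using h1
      · simpa [achievedGoal, stateAt] using h2
    · have hg : achievedGoal T s (a :: as) = achievedGoal T (T s a) as := by
        cases as with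
        | nil => exact absurd rfl h2.1
        | cons b bs => simp [achievedGoal, stateAt]
      obtain ⟨p, b, hp, hN, hT⟩ := ih _ h2
      rw [hg]
      exact ⟨a :: p, b, by rw [hp]; rfl, ⟨h1, hN⟩, hT⟩

theorem NPath.terminating {S A : Type*} {T : S → A → S} {Abs : Set S} {g : S} {a : A}
    (ha : T g a ∈ Abs) {p : List A} :
    ∀ {s : S}, NPath T Abs g s p → Terminating T Abs s (p ++ [a]) := by
  induction p with
  | nil =>
    rintro s ⟨rfl, h⟩
    exact (terminating_cons T Abs s a []).2 ⟨h, Or.inl ⟨rfl, ha⟩⟩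
  | cons b p ih =>
    intro s h
    exact (terminating_cons T Abs s b (p ++ [a])).2 ⟨h.1, Or.inr (ih h.2)⟩

theorem NPath.ret_append {S A : Type*} {T : S → A → S} {Abs : Set S} {g : S}
    (R Rb : S → A → S → ℝ)
    (hR : ∀ s a, T s a ∉ Abs → Rb s a (T s a) = R s a (T s a)) (a : A) {p : List A} :
    ∀ {s : S}, NPath T Abs g s p →
      ret T Rb s (p ++ [a]) = ret T R s p + Rb g a (T g a) := by
  induction p with
  | nil => rintro s ⟨rfl, h⟩; simp [ret]
  | cons b p ih =>
    intro s h
    have h1 := ih h.2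
    simp only [List.cons_append, ret]
    rw [h1, hR s b h.2.start]; ring

theorem NPath.ret_bounds {S A : Type*} {T : S → A → S} {Abs : Set S} {g : S}
    {R : S → A → S → ℝ} {m : ℝ}
    (h0 : ∀ s ∉ Abs, ∀ a, T s a ∉ Abs → R s a (T s a) ≤ 0)
    (hm : ∀ s ∉ Abs, ∀ a, m ≤ R s a (T s a)) {p : List A} :
    ∀ {s : S}, NPath T Abs g s p → ret T R s p ≤ 0 ∧ m * p.length ≤ ret T R s p := by
  induction p with
  | nil => intro s _; simp [ret]
  | cons b p ih =>
    intro s h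
    obtain ⟨h1, h2⟩ := ih h.2
    have h3 := h0 s h.1 b h.2.start
    have h4 := hm s h.1 b
    simp only [ret, List.length_cons]
    push_cast
    constructor <;> linarith

/-- Supremum of the returns of non-terminal paths from `s` to `g`. -/
noncomputable def Mval {S A : Type*} (T : S → A → S) (Abs : Set S) (R : S → A → S → ℝ)
    (s g : S) : ℝ :=
  sSup {x | ∃ p : List A, NPath T Abs g s p ∧ ret T R s p = x}

theorem vbar_of_isLUB {S A : Type*} (T : S → A → S) (Abs : Set S) (D : ℕ)
    (hProper : Proper T Abs D) (rb : ℝ) (R : S → A → S → ℝ) (s g : S) (hs : s ∉ Abs) (v : ℝ)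
    (hv : IsLUB {x | ∃ as, Terminating T Abs s as ∧ ret T (Rbar Abs rb R g) s as = x} v) :
    Vbar T Abs rb R s g = v := by
  have hQ : ∀ a, Qbar T Abs rb R s g a ≤ v := by
    intro a
    apply csSup_le
    · by_cases h : T s a ∈ Abs
      · exact ⟨_, [a], (terminating_cons T Abs s a []).2 ⟨hs, Or.inl ⟨rfl, h⟩⟩, rfl, rfl⟩
      · obtain ⟨as, has⟩ := hProper.2.1 _ h
        exact ⟨_, a :: as, (terminating_cons T Abs s a as).2 ⟨hs, Or.inr has⟩, rfl, rfl⟩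
    · rintro x ⟨as, h1, -, h2⟩
      exact hv.1 ⟨as, h1, h2⟩
  apply le_antisymm
  · apply csSup_le
    · obtain ⟨as, has⟩ := hProper.2.1 s hs
      cases as with
      | nil => exact absurd rfl has.1
      | cons a as => exact ⟨_, a, rfl⟩
    · rintro x ⟨a, rfl⟩
      exact hQ a
  · apply hv.2
    rintro x ⟨as, h1, h2⟩
    cases as with
    | nil => exact absurd rfl h1.1
    | cons a as =>
      calc x ≤ Qbar T Abs rb R s g a := by
            apply le_csSup
            · exact ⟨v, by rintro y ⟨bs, h3, -, h4⟩; exact hv.1 ⟨bs, h3, h4⟩⟩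
            · exact ⟨_, h1, rfl, h2⟩
        _ ≤ _ := by
            apply le_csSup
            · exact ⟨v, by rintro y ⟨b, rfl⟩; exact hQ b⟩
            · exact ⟨a, rfl⟩

theorem vbar_eq {S A : Type*} (T : S → A → S) (Abs : Set S)
    (R₁ R : S → A → S → ℝ) (rMIN rMAX rbMIN : ℝ) (D : ℕ)
    (hProper : Proper T Abs D)
    (hagree : ∀ (s : S) (a : A), T s a ∉ Abs → R s a (T s a) = R₁ s a (T s a))
    (hbound₁ : ∀ s ∉ Abs, ∀ a : A, rMIN ≤ R₁ s a (T s a) ∧ R₁ s a (T s a) < rMAX)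
    (hbound : ∀ s ∉ Abs, ∀ a : A, rMIN ≤ R s a (T s a) ∧ R s a (T s a) < rMAX)
    (hrMIN : rMIN ≤ 0) (hrMAX : 0 < rMAX)
    (hrb : rbMIN = (rMIN - rMAX) * D)
    (hnonpos : ∀ s ∉ Abs, ∀ a : A, T s a ∉ Abs → R₁ s a (T s a) ≤ 0)
    (s g : S) (hg : g ∈ goalSet T Abs) (p₀ : List A) (hp₀ : NPath T Abs g s p₀) :
    Vbar T Abs rbMIN R s g = Mval T Abs R₁ s g + Rterm T Abs R g := by
  have hgA := hp₀.goal
  obtain ⟨a₀, ha₀⟩ := hg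
  have hB : ∀ {k p}, NPath T Abs k s p →
      ret T R₁ s p ≤ 0 ∧ rMIN * p.length ≤ ret T R₁ s p := fun h =>
    h.ret_bounds hnonpos (fun s hs a => (hbound₁ s hs a).1)
  have hRb : ∀ s a, T s a ∉ Abs →
      Rbar Abs rbMIN R g s a (T s a) = R₁ s a (T s a) := by
    intro s a h
    simp [Rbar, h, hagree s a h]
  have hM : ∀ p, NPath T Abs g s p → ret T R₁ s p ≤ Mval T Abs R₁ s g := by
    intro p hp
    apply le_csSup
    · exact ⟨0, by rintro x ⟨q, hq, rfl⟩; exact (hB hq).1⟩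
    · exact ⟨p, hp, rfl⟩
  have hT : ∀ a, T g a ∈ Abs → R g a (T g a) ≤ Rterm T Abs R g := by
    intro a ha
    apply le_csSup
    · exact ⟨rMAX, by rintro x ⟨b, _, rfl⟩; exact (hbound g hgA b).2.le⟩
    · exact ⟨a, ha, rfl⟩
  apply vbar_of_isLUB T Abs D hProper rbMIN R s g hp₀.start
  constructor
  · rintro x ⟨as, has, rfl⟩
    obtain ⟨p, a, hpa, hN, ha⟩ := terminating_decomp T Abs as s has
    generalize achievedGoal T s as = k at hN ha
    rw [hpa, hN.ret_append R₁ _ hRb a]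
    by_cases hgg : k = g
    · subst hgg
      have h1 := hM p hN
      have h2 := hT a ha
      have h3 : Rbar Abs rbMIN R k k a (T k a) = R k a (T k a) := by simp [Rbar]
      linarith
    · have h3 : Rbar Abs rbMIN R g k a (T k a) = rbMIN := by simp [Rbar, hgg, ha]
      have h1 := (hB hN).1
      have h2 := hM p₀ hp₀
      have h4 := (hB hp₀).2
      have h5 := hT a₀ ha₀
      have h6 := (hbound g hgA a₀).1
      have h7 : ((p₀.length : ℝ) + 1) ≤ D := by
        have := hProper.2.2 s _ (hp₀.terminating ha₀)
        simp only [List.length_append, List.length_singleton] at this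
        exact_mod_cast this
      have h8 : rMIN * D ≤ rMIN * ((p₀.length : ℝ) + 1) :=
        mul_le_mul_of_nonpos_left h7 hrMIN
      have h9 : 0 ≤ rMAX * D := by positivity
      rw [h3, hrb]
      linarith
  · intro b hb
    have key : Mval T Abs R₁ s g ≤ b - Rterm T Abs R g := by
      refine csSup_le ⟨_, p₀, hp₀, rfl⟩ ?_
      rintro x ⟨p, hp, rfl⟩
      have : Rterm T Abs R g ≤ b - ret T R₁ s p := by
        refine csSup_le ⟨_, a₀, ha₀, rfl⟩ ?_
        rintro x ⟨a, ha, rfl⟩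
        have h1 := hb ⟨_, hp.terminating ha, rfl⟩
        rw [hp.ret_append R₁ _ hRb a] at h1
        have h3 : Rbar Abs rbMIN R g g a (T g a) = R g a (T g a) := by simp [Rbar]
        linarith
      linarith
    linarith

/-- **Theorem 4(i)**: if `R₁` and `R₂` agree on non-terminal transitions, both satisfy the
mastery hypotheses, and non-terminal rewards are non-positive, then for every `s ∉ Abs` and
every goal `g ∈ G` reachable from `s`,
`V̄*₂(s, g) = V̄*₁(s, g) + (Rterm₂(g) − V̄*₁(g, g))`. -/
theorem vbar_transfer {S A : Type*} (T : S → A → S) (Abs : Set S)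
    (R₁ R₂ : S → A → S → ℝ) (rMIN rMAX rbMIN : ℝ) (D : ℕ)
    (hProper : Proper T Abs D)
    (hagree : ∀ (s : S) (a : A), T s a ∉ Abs → R₁ s a (T s a) = R₂ s a (T s a))
    (hbound₁ : ∀ s ∉ Abs, ∀ a : A, rMIN ≤ R₁ s a (T s a) ∧ R₁ s a (T s a) < rMAX)
    (hbound₂ : ∀ s ∉ Abs, ∀ a : A, rMIN ≤ R₂ s a (T s a) ∧ R₂ s a (T s a) < rMAX)
    (hrMIN : rMIN ≤ 0) (hrMAX : 0 < rMAX)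
    (hrb : rbMIN = (rMIN - rMAX) * D)
    (hnonpos : ∀ s ∉ Abs, ∀ a : A, T s a ∉ Abs → R₁ s a (T s a) ≤ 0) :
    ∀ s ∉ Abs, ∀ g ∈ goalSet T Abs, Reachable T Abs s g →
      Vbar T Abs rbMIN R₂ s g =
        Vbar T Abs rbMIN R₁ s g +
          (Rterm T Abs R₂ g - Vbar T Abs rbMIN R₁ g g) := by
  intro s hs g hg ⟨as, has, hasg⟩
  obtain ⟨p, a, -, hN, -⟩ := terminating_decomp T Abs as s has
  rw [hasg] at hN
  have hN0 : NPath T Abs g g [] := ⟨rfl, hN.goal⟩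
  have hM : Mval T Abs R₁ g g = 0 := by
    refine IsLUB.csSup_eq ?_ ⟨_, [], hN0, rfl⟩
    constructor
    · rintro x ⟨q, hq, rfl⟩
      exact (hq.ret_bounds hnonpos (fun s hs a => (hbound₁ s hs a).1)).1
    · intro b hb
      exact hb ⟨[], hN0, rfl⟩
  rw [vbar_eq T Abs R₁ R₂ rMIN rMAX rbMIN D hProper (fun s a h => (hagree s a h).symm)
      hbound₁ hbound₂ hrMIN hrMAX hrb hnonpos s g hg p hN,
    vbar_eq T Abs R₁ R₁ rMIN rMAX rbMIN D hProper (fun s a h => rfl)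
      hbound₁ hbound₁ hrMIN hrMAX hrb hnonpos s g hg p hN,
    vbar_eq T Abs R₁ R₁ rMIN rMAX rbMIN D hProper (fun s a h => rfl)
      hbound₁ hbound₁ hrMIN hrMAX hrb hnonpos g g hg [] hN0, hM]
  ring
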